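/- arXiv:1702.01843 — 3 statements merged into one kernel-verified Lean document; each statement's English description precedes it below -/
import Mathlib

section
/- Let (V, E, s, t) be a finite connected directed multigraph and let a : E → ℝ be an assignment of a real number to each edge (a density). Then there exist functions p, q : E → ℝ (interpreted as the limit values of an antiderivative of a at the source and target endpoint of each edge) satisfying the Newton–Leibniz rule q(e) − p(e) = a(e) for every edge e, and the Kirchhoff rule at every vertex v: the sum of q(e) over all edges e with t(e) = v equals the sum of p(e) over all edges e with s(e) = v, if and only if the total sum of a(e) over all edges e ∈ E is zero. -/
open Finset

/-- In a graph whose edges connect `u` to `v`, the difference of the point masses at `v` and `u`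
lies in the span of the boundaries of the edges. -/
lemma single_sub_single_mem_span_boundary {V E R : Type*} [DecidableEq V] [Ring R]
    (s t : E → V) {u v : V}
    (h : Relation.EqvGen (fun x y => ∃ e : E, s e = x ∧ t e = y) u v) :
    (Pi.single v 1 - Pi.single u 1 : V → R) ∈ Submodule.span R
      (Set.range fun e => (Pi.single (t e) 1 - Pi.single (s e) 1 : V → R)) := by
  induction h with
  | rel x y h =>
    obtain ⟨e, rfl, rfl⟩ := h
    exact Submodule.subset_span ⟨e, rfl⟩
  | refl x => simp
  | symm x y _ ih => simpa using Submodule.neg_mem _ ih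
  | trans x y z _ _ ihxy ihyz => simpa using Submodule.add_mem _ ihyz ihxy

/-- On a connected graph, every function on the vertices with vanishing total sum is the boundary
of a function on the edges. -/
lemma exists_boundary_eq_of_sum_eq_zero {V E R : Type*} [Fintype V] [Fintype E] [DecidableEq V]
    [Ring R] (s t : E → V) (r : V)
    (hr : ∀ v : V, Relation.EqvGen (fun x y => ∃ e : E, s e = x ∧ t e = y) r v)
    (b : V → R) (hb : ∑ v, b v = 0) :
    ∃ p : E → R, ∀ v : V,
      ∑ e ∈ Finset.univ.filter (fun e => t e = v), p e -
        ∑ e ∈ Finset.univ.filter (fun e => s e = v), p e = b v := by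
  have hdecomp : b = ∑ v, b v • (Pi.single v 1 - Pi.single r 1 : V → R) := by
    simp only [smul_sub, Finset.sum_sub_distrib, ← Finset.sum_smul, hb, zero_smul, sub_zero]
    ext w
    simp [Finset.sum_apply, Pi.single_apply]
  have hmem : b ∈ Submodule.span R
      (Set.range fun e => (Pi.single (t e) 1 - Pi.single (s e) 1 : V → R)) := by
    rw [hdecomp]
    exact Submodule.sum_mem _ fun v _ =>
      Submodule.smul_mem _ _ (single_sub_single_mem_span_boundary s t (hr v))
  obtain ⟨p, hp⟩ := (Submodule.mem_span_range_iff_exists_fun R).1 hmem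
  refine ⟨p, fun v => ?_⟩
  rw [← hp]
  simp [Finset.sum_apply, Pi.single_apply, mul_sub, Finset.sum_sub_distrib, Finset.sum_filter,
    eq_comm]

/-- **Existence of antiderivatives of a density on a graph.**
For a finite connected directed multigraph `(V, E, s, t)` and a density `a : E → ℝ`,
there exist limit values `p, q : E → ℝ` of an antiderivative (at the source and target
of each edge) satisfying the Newton–Leibniz rule `q e - p e = a e` on every edge and
the Kirchhoff rule at every vertex, if and only if the total sum of `a` vanishes. -/
theorem exists_antiderivative_iff_total_sum_zero
    {V E : Type*} [Fintype V] [Fintype E] [DecidableEq V]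
    (s t : E → V) (a : E → ℝ)
    (hconn : Nonempty V ∧ ∀ u v : V,
      Relation.EqvGen (fun x y => ∃ e : E, s e = x ∧ t e = y) u v) :
    (∃ p q : E → ℝ,
      (∀ e : E, q e - p e = a e) ∧
      (∀ v : V,
        ∑ e ∈ Finset.univ.filter (fun e => t e = v), q e =
        ∑ e ∈ Finset.univ.filter (fun e => s e = v), p e)) ↔
    ∑ e : E, a e = 0 := by
  constructor
  · rintro ⟨p, q, hpq, hK⟩
    have hsum : ∑ e, q e = ∑ e, p e := by
      rw [← Finset.sum_fiberwise Finset.univ t q, ← Finset.sum_fiberwise Finset.univ s p]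
      exact Finset.sum_congr rfl fun v _ => hK v
    simp_rw [← hpq, Finset.sum_sub_distrib, hsum, sub_self]
  · intro ha
    obtain ⟨⟨r⟩, hconn⟩ := hconn
    obtain ⟨p, hp⟩ := exists_boundary_eq_of_sum_eq_zero s t r (hconn r)
      (fun v => -∑ e ∈ Finset.univ.filter (fun e => t e = v), a e)
      (by rw [Finset.sum_neg_distrib, Finset.sum_fiberwise, ha, neg_zero])
    refine ⟨p, fun e => p e + a e, fun e => add_sub_cancel_left _ _, fun v => ?_⟩
    rw [Finset.sum_add_distrib]
    linarith [hp v]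
end

section
/- Let (m_k)_{k≥0} be a sequence of real numbers such that for all natural numbers k and n the alternating binomial sum Σ_{j=0}^{n} (−1)^j · (n choose j) · m_{k+j} is nonnegative. Then there exists a finite Borel measure μ on ℝ, supported in the interval [0, 1], whose moments are exactly the given sequence: ∫ x^k dμ(x) = m_k for every k. -/
open MeasureTheory Finset

open Filter Topology CompactlySupported unitInterval bernstein
open scoped Polynomial

/-- A positive linear functional on `C(X, ℝ)`, for compact `X`, is integration against a finite
measure. -/
theorem exists_isFiniteMeasure_integral_eq {X : Type*} [TopologicalSpace X] [CompactSpace X]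
    [T2Space X] [MeasurableSpace X] [BorelSpace X] (Λ : C(X, ℝ) →ₗ[ℝ] ℝ)
    (hΛ : ∀ f, 0 ≤ f → 0 ≤ Λ f) :
    ∃ μ : Measure X, IsFiniteMeasure μ ∧ ∀ f : C(X, ℝ), ∫ x, f x ∂μ = Λ f := by
  let Φ : C_c(X, ℝ) →ₚ[ℝ] ℝ := PositiveLinearMap.mk₀
    { toFun := fun f => Λ f.toContinuousMap
      map_add' := fun f g => Λ.map_add f.toContinuousMap g.toContinuousMap
      map_smul' := fun c f => Λ.map_smul c f.toContinuousMap }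
    (fun f hf => hΛ f.toContinuousMap hf)
  refine ⟨RealRMK.rieszMeasure Φ, inferInstance, fun f => ?_⟩
  exact RealRMK.integral_rieszMeasure Φ (CompactlySupportedContinuousMap.continuousMapEquiv f)

/-- A uniformly bounded sequence of positive linear functionals on `C(X, ℝ)` has a positive linear
functional as a pointwise limit along any ultrafilter. -/
theorem exists_linearMap_tendsto_ultrafilter {X : Type*} [TopologicalSpace X] [CompactSpace X]
    {ι : Type*} (l : Ultrafilter ι) (T : ι → C(X, ℝ) →ₗ[ℝ] ℝ) (C : ℝ)
    (hpos : ∀ i f, 0 ≤ f → 0 ≤ T i f) (hbound : ∀ i f, |T i f| ≤ C * ‖f‖) :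
    ∃ Λ : C(X, ℝ) →ₗ[ℝ] ℝ, (∀ f, 0 ≤ f → 0 ≤ Λ f) ∧
      ∀ f, Tendsto (fun i => T i f) l (𝓝 (Λ f)) := by
  have hlim : ∀ f, ∃ a, Tendsto (fun i => T i f) l (𝓝 a) := by
    intro f
    obtain ⟨a, -, ha⟩ := (isCompact_Icc (a := -(C * ‖f‖)) (b := C * ‖f‖)).ultrafilter_le_nhds
      (l.map fun i => T i f)
      (le_principal_iff.2 (Filter.mem_map.2 (Eventually.of_forall fun i => abs_le.1 (hbound i f))))
    exact ⟨a, ha⟩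
  choose Λ hΛ using hlim
  refine ⟨{ toFun := Λ
            map_add' := fun f g => tendsto_nhds_unique (hΛ (f + g)) ?_
            map_smul' := fun c f => tendsto_nhds_unique (hΛ (c • f)) ?_ }, fun f hf => ?_, hΛ⟩
  · simpa only [map_add] using (hΛ f).add (hΛ g)
  · simpa only [map_smul, RingHom.id_apply] using (hΛ f).const_smul c
  · exact ge_of_tendsto' (hΛ f) fun i => hpos i f hf

theorem Nat.cast_descFactorial_eq_prod_range {R : Type*} [CommRing R] (n k : ℕ) :
    (n.descFactorial k : R) = ∏ j ∈ range k, ((n : R) - j) := by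
  induction k with
  | zero => simp
  | succ k ih =>
    rw [prod_range_succ, ← ih, Nat.descFactorial_succ, Nat.cast_mul, mul_comm]
    rcases le_or_gt k n with h | h
    · rw [Nat.cast_sub h]
    · simp [Nat.descFactorial_eq_zero_iff_lt.2 h]

/-- The factorial moments of the Bernstein basis. -/
theorem bernsteinPolynomial.sum_descFactorial_mul (R : Type*) [CommRing R] {n k : ℕ} (h : k ≤ n) :
    ∑ i ∈ range (n + 1), (i.descFactorial k : R[X]) * bernsteinPolynomial R n i =
      (n.descFactorial k : R[X]) * Polynomial.X ^ k := by
  obtain ⟨d, rfl⟩ := Nat.exists_eq_add_of_le h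
  rw [add_assoc, sum_range_add, sum_eq_zero, zero_add]
  · have hsum := bernsteinPolynomial.sum R d
    rw [← mul_one (((k + d).descFactorial k : R[X]) * Polynomial.X ^ k), ← hsum, mul_sum]
    refine sum_congr rfl fun i _ => ?_
    have hc : (k + i).descFactorial k * (k + d).choose (k + i) =
        (k + d).descFactorial k * d.choose i := by
      have := Nat.choose_mul (n := k + d) (k := k + i) (s := k) (by omega)
      rw [Nat.add_sub_cancel_left, Nat.add_sub_cancel_left] at this
      rw [Nat.descFactorial_eq_factorial_mul_choose, Nat.descFactorial_eq_factorial_mul_choose,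
        mul_assoc, mul_assoc, ← this, mul_comm ((k + i).choose k)]
    have hc' := congrArg (Nat.cast : ℕ → R[X]) hc
    push_cast at hc'
    simp only [bernsteinPolynomial, Nat.add_sub_add_left, pow_add]
    linear_combination Polynomial.X ^ k * Polynomial.X ^ i * (1 - Polynomial.X) ^ (d - i) * hc'
  · intro i hi
    simp [Nat.descFactorial_eq_zero_iff_lt.2 (mem_range.1 hi)]

/-- The linear functional on polynomials sending `X ^ k` to `m k`. -/
noncomputable def momentFunctional (m : ℕ → ℝ) : ℝ[X] →ₗ[ℝ] ℝ :=
  (Polynomial.basisMonomials ℝ).constr ℝ m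

theorem momentFunctional_X_pow (m : ℕ → ℝ) (k : ℕ) :
    momentFunctional m (Polynomial.X ^ k) = m k := by
  have := (Polynomial.basisMonomials ℝ).constr_basis ℝ m k
  simpa only [momentFunctional, Polynomial.coe_basisMonomials,
    Polynomial.monomial_one_right_eq_X_pow] using this

theorem momentFunctional_natCast_mul (m : ℕ → ℝ) (a : ℕ) (p : ℝ[X]) :
    momentFunctional m (a * p) = a * momentFunctional m p := by
  rw [← nsmul_eq_mul, map_nsmul, nsmul_eq_mul]

theorem momentFunctional_bernsteinPolynomial_nonneg {m : ℕ → ℝ}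
    (hmono : ∀ k n : ℕ,
      0 ≤ ∑ j ∈ Finset.range (n + 1), (-1 : ℝ) ^ j * (n.choose j : ℝ) * m (k + j)) (n i : ℕ) :
    0 ≤ momentFunctional m (bernsteinPolynomial ℝ n i) := by
  rw [bernsteinPolynomial, mul_assoc, momentFunctional_natCast_mul]
  refine mul_nonneg (Nat.cast_nonneg _) ?_
  refine (hmono i (n - i)).trans_eq (Eq.symm ?_)
  rw [sub_eq_neg_add, add_pow, mul_sum, map_sum]
  refine sum_congr rfl fun j _ => ?_
  rw [← momentFunctional_X_pow m (i + j), ← smul_eq_mul (α := ℝ), ← map_smul,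
    Polynomial.smul_eq_C_mul]
  congr 1
  simp only [one_pow, mul_one, map_mul, map_pow, map_neg, map_one, map_natCast,
    neg_pow (Polynomial.X : ℝ[X]), pow_add]
  ring

/-- The functional sending `f` to the value of `momentFunctional m` at the `n`-th Bernstein
approximation of `f`. -/
noncomputable def bernsteinFunctional (m : ℕ → ℝ) (n : ℕ) : C(I, ℝ) →ₗ[ℝ] ℝ where
  toFun f := ∑ i : Fin (n + 1), f (z i) * momentFunctional m (bernsteinPolynomial ℝ n i)
  map_add' f g := by simp [add_mul, sum_add_distrib]
  map_smul' c f := by simp [mul_sum, mul_assoc]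

theorem bernsteinFunctional_apply (m : ℕ → ℝ) (n : ℕ) (f : C(I, ℝ)) :
    bernsteinFunctional m n f =
      ∑ i : Fin (n + 1), f (z i) * momentFunctional m (bernsteinPolynomial ℝ n i) := rfl

theorem bernsteinFunctional_nonneg {m : ℕ → ℝ}
    (hm : ∀ n i, 0 ≤ momentFunctional m (bernsteinPolynomial ℝ n i)) (n : ℕ) (f : C(I, ℝ))
    (hf : 0 ≤ f) : 0 ≤ bernsteinFunctional m n f := by
  rw [bernsteinFunctional_apply]
  exact sum_nonneg fun i _ => mul_nonneg (hf (z i)) (hm n i)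

theorem abs_bernsteinFunctional_le {m : ℕ → ℝ}
    (hm : ∀ n i, 0 ≤ momentFunctional m (bernsteinPolynomial ℝ n i)) (n : ℕ) (f : C(I, ℝ)) :
    |bernsteinFunctional m n f| ≤ m 0 * ‖f‖ := by
  have hsum : ∑ i : Fin (n + 1), momentFunctional m (bernsteinPolynomial ℝ n i) = m 0 := by
    rw [Fin.sum_univ_eq_sum_range (fun i => momentFunctional m (bernsteinPolynomial ℝ n i)),
      ← map_sum, bernsteinPolynomial.sum, ← momentFunctional_X_pow m 0, pow_zero]
  rw [← hsum, sum_mul, bernsteinFunctional_apply]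
  refine (abs_sum_le_sum_abs _ _).trans (sum_le_sum fun i _ => ?_)
  rw [abs_mul, abs_of_nonneg (hm n i), mul_comm]
  exact mul_le_mul_of_nonneg_left (f.norm_coe_le_norm (z i)) (hm n i)

/-- The inclusion of the unit interval in `ℝ` as a continuous map. -/
def unitIntervalCoe : C(I, ℝ) := ⟨Subtype.val, continuous_subtype_val⟩

theorem bernsteinFunctional_prod_sub (m : ℕ → ℝ) {n k : ℕ} (hn : n ≠ 0) (hk : k ≤ n) :
    bernsteinFunctional m n
        (∏ j ∈ range k, (unitIntervalCoe - ContinuousMap.const I ((j : ℝ) / n))) =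
      (∏ j ∈ range k, (1 - (j : ℝ) / n)) * m k := by
  have hn' : (n : ℝ) ≠ 0 := Nat.cast_ne_zero.2 hn
  have hprod : ∀ i : ℕ, ∏ j ∈ range k, ((i : ℝ) / n - (j : ℝ) / n) =
      ((n : ℝ) ^ k)⁻¹ * i.descFactorial k := by
    intro i
    simp only [← sub_div, prod_div_distrib, prod_const, card_range,
      ← Nat.cast_descFactorial_eq_prod_range]
    rw [div_eq_inv_mul]
  have hone := hprod n
  rw [div_self hn'] at hone
  rw [hone, bernsteinFunctional_apply, mul_assoc, ← momentFunctional_X_pow m k,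
    ← momentFunctional_natCast_mul, ← bernsteinPolynomial.sum_descFactorial_mul ℝ hk, map_sum,
    mul_sum, ← Fin.sum_univ_eq_sum_range (fun i => ((n : ℝ) ^ k)⁻¹ *
      momentFunctional m ((i.descFactorial k : ℝ[X]) * bernsteinPolynomial ℝ n i))]
  refine sum_congr rfl fun i _ => ?_
  rw [momentFunctional_natCast_mul, ← mul_assoc, ← hprod]
  simp [unitIntervalCoe, z]

theorem tendsto_bernsteinFunctional_pow {m : ℕ → ℝ}
    (hm : ∀ n i, 0 ≤ momentFunctional m (bernsteinPolynomial ℝ n i)) (k : ℕ) :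
    Tendsto (fun n => bernsteinFunctional m n (unitIntervalCoe ^ k)) atTop (𝓝 (m k)) := by
  let q : ℕ → C(I, ℝ) := fun n =>
    ∏ j ∈ range k, (unitIntervalCoe - ContinuousMap.const I ((j : ℝ) / n))
  have hq : Tendsto q atTop (𝓝 (unitIntervalCoe ^ k)) := by
    have h : ∀ j ∈ range k, Tendsto (fun n : ℕ =>
        unitIntervalCoe - ContinuousMap.const I ((j : ℝ) / n)) atTop (𝓝 unitIntervalCoe) := by
      intro j _
      have hc := (ContinuousMap.continuous_const' (X := I) (Y := ℝ)).tendsto 0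
      simpa using tendsto_const_nhds.sub (hc.comp (tendsto_const_div_atTop_nhds_zero_nat (j : ℝ)))
    simpa using tendsto_finsetProd _ h
  have hTq : Tendsto (fun n => bernsteinFunctional m n (q n)) atTop (𝓝 (m k)) := by
    have h : ∀ j ∈ range k, Tendsto (fun n : ℕ => 1 - (j : ℝ) / n) atTop (𝓝 1) := by
      intro j _
      simpa using tendsto_const_nhds.sub (tendsto_const_div_atTop_nhds_zero_nat (j : ℝ))
    have h' := (tendsto_finsetProd _ h).mul_const (m k)
    rw [prod_const_one, one_mul] at h'
    refine h'.congr' ?_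
    filter_upwards [eventually_ge_atTop k, eventually_ne_atTop 0] with n hk hn
    exact (bernsteinFunctional_prod_sub m hn hk).symm
  have hdiff : Tendsto (fun n => bernsteinFunctional m n (unitIntervalCoe ^ k - q n)) atTop
      (𝓝 0) := by
    refine squeeze_zero_norm (fun n => abs_bernsteinFunctional_le hm n _) ?_
    simpa using ((tendsto_const_nhds.sub hq).norm.const_mul (m 0) :
      Tendsto (fun n => m 0 * ‖unitIntervalCoe ^ k - q n‖) atTop _)
  simpa using hdiff.add hTq

/-- **Existence in the Hausdorff moment problem.**
A sequence `(m_k)` of real numbers whose alternating binomial sums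
`Σ_{j=0}^n (-1)^j (n choose j) m_{k+j}` are all nonnegative (a completely monotone
sequence) is the moment sequence of a finite Borel measure supported in `[0, 1]`. -/
theorem exists_measure_of_completely_monotone
    (m : ℕ → ℝ)
    (hmono : ∀ k n : ℕ,
      0 ≤ ∑ j ∈ Finset.range (n + 1), (-1 : ℝ) ^ j * (n.choose j : ℝ) * m (k + j)) :
    ∃ μ : Measure ℝ, IsFiniteMeasure μ ∧ μ (Set.Icc (0 : ℝ) 1)ᶜ = 0 ∧
      ∀ k : ℕ, ∫ x, x ^ k ∂μ = m k := by
  have hm := momentFunctional_bernsteinPolynomial_nonneg hmono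
  obtain ⟨Λ, hΛ, hlim⟩ := exists_linearMap_tendsto_ultrafilter (hyperfilter ℕ)
    (bernsteinFunctional m) (m 0)
    (bernsteinFunctional_nonneg hm) (abs_bernsteinFunctional_le hm)
  obtain ⟨ν, hν, hint⟩ := exists_isFiniteMeasure_integral_eq Λ hΛ
  refine ⟨ν.map Subtype.val, inferInstance, ?_, fun k => ?_⟩
  · rw [Measure.map_apply measurable_subtype_coe measurableSet_Icc.compl]
    convert measure_empty (μ := ν)
    ext x
    simp
  · rw [(MeasurableEmbedding.subtype_coe measurableSet_Icc).integral_map]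
    refine (hint (unitIntervalCoe ^ k)).trans (tendsto_nhds_unique (hlim _) ?_)
    exact (tendsto_bernsteinFunctional_pow hm k).mono_left Nat.hyperfilter_le_atTop
end

section
/- Let L > 0 and let w : ℝ → ℝ be a continuous function vanishing outside the interval [−L, L]. Define Φ : ℂ → ℂ by Φ(λ) := ∫_{−L}^{L} w(z)/(λ − z) dz for λ ∉ [−L, L] (with z viewed as a complex number). Then for every x ∈ (−L, L), the normalized jump of Φ across the real axis recovers the density: the limit as ε → 0⁺ of (Φ(x − iε) − Φ(x + iε))/(2πi) exists and equals w(x). -/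
open MeasureTheory Complex Filter Topology

theorem tendsto_integral_comp_add_mul_inv_one_add_sq {w : ℝ → ℝ} (hw : Continuous w) {C : ℝ}
    (hC : ∀ z, ‖w z‖ ≤ C) (x : ℝ) :
    Tendsto (fun ε : ℝ => ∫ t : ℝ, w (x + ε * t) * (1 + t ^ 2)⁻¹) (𝓝 0)
      (𝓝 (w x * Real.pi)) := by
  have h : w x * Real.pi = ∫ t : ℝ, w x * (1 + t ^ 2)⁻¹ := by
    rw [integral_const_mul, integral_univ_inv_one_add_sq]
  rw [h]
  refine tendsto_integral_filter_of_dominated_convergence (fun t : ℝ => C * (1 + t ^ 2)⁻¹)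
    (.of_forall fun ε => ?_) (.of_forall fun ε => .of_forall fun t => ?_)
    (integrable_inv_one_add_sq.const_mul C) (.of_forall fun t => ?_)
  · exact ((by fun_prop : Continuous fun t : ℝ => w (x + ε * t)).aestronglyMeasurable).mul
      integrable_inv_one_add_sq.aestronglyMeasurable
  · rw [norm_mul, Real.norm_of_nonneg (by positivity : 0 ≤ (1 + t ^ 2)⁻¹)]
    exact mul_le_mul_of_nonneg_right (hC _) (by positivity)
  · have hc : Continuous fun ε : ℝ => w (x + ε * t) * (1 + t ^ 2)⁻¹ := by fun_prop
    simpa using hc.tendsto 0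

theorem integral_mul_poissonKernel_eq (w : ℝ → ℝ) (x : ℝ) {ε : ℝ} (hε : 0 < ε) :
    ∫ z : ℝ, w z * (ε / ((x - z) ^ 2 + ε ^ 2)) =
      ∫ t : ℝ, w (x + ε * t) * (1 + t ^ 2)⁻¹ := by
  let f : ℝ → ℝ := fun z => w z * (ε / ((x - z) ^ 2 + ε ^ 2))
  have hf : ∀ t, w (x + ε * t) * (1 + t ^ 2)⁻¹ = ε * f (x + ε * t) := by
    intro t
    have h : (x - (x + ε * t)) ^ 2 + ε ^ 2 = ε ^ 2 * (1 + t ^ 2) := by ring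
    simp only [f, h]
    field_simp
  simp_rw [hf]
  rw [integral_const_mul, Measure.integral_comp_mul_left (fun s => f (x + s)) ε,
    integral_add_left_eq_self f x, abs_of_pos (inv_pos.2 hε), smul_eq_mul,
    mul_inv_cancel_left₀ hε.ne']

theorem ofReal_add_mul_I_sub_ofReal_ne_zero (x z : ℝ) {ε : ℝ} (hε : ε ≠ 0) :
    (x : ℂ) + (ε : ℂ) * I - (z : ℂ) ≠ 0 := fun h => hε (by simpa using congrArg Complex.im h)

theorem ofReal_sub_mul_I_sub_ofReal_ne_zero (x z : ℝ) {ε : ℝ} (hε : ε ≠ 0) :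
    (x : ℂ) - (ε : ℂ) * I - (z : ℂ) ≠ 0 := fun h => hε (by simpa using congrArg Complex.im h)

theorem div_sub_div_conj_eq_poissonKernel (a x z : ℝ) {ε : ℝ} (hε : ε ≠ 0) :
    ((a : ℂ) / ((x : ℂ) - (ε : ℂ) * I - (z : ℂ)) - (a : ℂ) / ((x : ℂ) + (ε : ℂ) * I - (z : ℂ))) =
      2 * I * ((a * (ε / ((x - z) ^ 2 + ε ^ 2)) : ℝ) : ℂ) := by
  have h₁ := ofReal_sub_mul_I_sub_ofReal_ne_zero x z hε
  have h₂ := ofReal_add_mul_I_sub_ofReal_ne_zero x z hε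
  have h₃ : ((x : ℂ) - z) ^ 2 + (ε : ℂ) ^ 2 =
      ((x : ℂ) - (ε : ℂ) * I - (z : ℂ)) * ((x : ℂ) + (ε : ℂ) * I - (z : ℂ)) := by
    linear_combination (ε : ℂ) ^ 2 * I_sq
  push_cast
  rw [h₃, div_sub_div _ _ h₁ h₂]
  field_simp
  ring

/-- **The Sokhotski–Plemelj jump formula recovers the density.**
Let `w` be a continuous density vanishing outside `[-L, L]` and let
`Φ(λ) = ∫_{-L}^{L} w(z)/(λ - z) dz` be its Stieltjes transform. Then for every
`x ∈ (-L, L)`, the normalized jump `(Φ(x - iε) - Φ(x + iε))/(2πi)` tends to `w(x)`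
as `ε → 0⁺`. -/
theorem stieltjes_jump_recovers_density
    (L : ℝ) (hL : 0 < L)
    (w : ℝ → ℝ) (hw : Continuous w)
    (hsupp : ∀ z : ℝ, z ∉ Set.Icc (-L) L → w z = 0)
    (Φ : ℂ → ℂ)
    (hΦ : ∀ lam : ℂ, lam ∉ (fun z : ℝ => (z : ℂ)) '' Set.Icc (-L) L →
      Φ lam = ∫ z in (-L)..L, (w z : ℂ) / (lam - (z : ℂ))) :
    ∀ x ∈ Set.Ioo (-L) L,
      Tendsto
        (fun ε : ℝ =>
          (Φ ((x : ℂ) - (ε : ℂ) * Complex.I) - Φ ((x : ℂ) + (ε : ℂ) * Complex.I)) /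
            (2 * (Real.pi : ℂ) * Complex.I))
        (𝓝[>] (0 : ℝ)) (𝓝 ((w x : ℂ))) := by
  intro x _
  have hcs : HasCompactSupport w := HasCompactSupport.intro isCompact_Icc fun z hz => hsupp z hz
  obtain ⟨C, hC⟩ := hw.bounded_above_of_compact_support hcs
  have hlim := ((tendsto_integral_comp_add_mul_inv_one_add_sq hw hC x).mono_left
    (nhdsWithin_le_nhds (s := Set.Ioi 0))).div_const Real.pi
  rw [mul_div_cancel_right₀ _ Real.pi_ne_zero] at hlim
  refine ((continuous_ofReal.tendsto (w x)).comp hlim).congr' ?_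
  filter_upwards [self_mem_nhdsWithin] with ε hε
  have hε : 0 < ε := hε
  have h₁ := fun z => ofReal_sub_mul_I_sub_ofReal_ne_zero x z hε.ne'
  have h₂ := fun z => ofReal_add_mul_I_sub_ofReal_ne_zero x z hε.ne'
  rw [hΦ, hΦ, ← intervalIntegral.integral_sub]
  · simp_rw [div_sub_div_conj_eq_poissonKernel _ x _ hε.ne']
    rw [intervalIntegral.integral_const_mul, intervalIntegral.integral_ofReal,
      intervalIntegral.integral_of_le (by linarith), ← integral_Icc_eq_integral_Ioc,
      setIntegral_eq_integral_of_forall_compl_eq_zero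
        fun z hz => by rw [hsupp z hz, zero_mul],
      integral_mul_poissonKernel_eq w x hε]
    have hpi : (Real.pi : ℂ) ≠ 0 := ofReal_ne_zero.2 Real.pi_ne_zero
    simp only [Function.comp_apply, ofReal_div]
    field_simp [I_ne_zero]
  · exact ((continuous_ofReal.comp hw).div (by fun_prop) h₁).intervalIntegrable _ _
  · exact ((continuous_ofReal.comp hw).div (by fun_prop) h₂).intervalIntegrable _ _
  · rintro ⟨z, -, hz⟩
    exact h₂ z (by simp [← hz])
  · rintro ⟨z, -, hz⟩
    exact h₁ z (by simp [← hz])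
end
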